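/- For every integer k ≥ 1, every i ∈ {0, 1, …, 2^k−1}, and every x ∈ [0,1] with i/2^k ≤ x ≤ (i+1)/2^k, one has f̃_k(x) − x² = −(x − i/2^k)(x − (i+1)/2^k). In particular, 0 ≤ f̃_k(x) − x² ≤ 4^{−(k+1)} for every x ∈ [0,1]. -/

import Mathlib

/-- The tent (sawtooth) map `T₁`. -/
noncomputable def T1 (x : ℝ) : ℝ := if x ≤ 1/2 then 2*x else 2*(1-x)

/-- `f̃_k(x) = x − Σ_{i=1}^k T_i(x)/4^i`, where `T_i = T₁^[i]`. -/
noncomputable def ftilde (k : ℕ) (x : ℝ) : ℝ :=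
  x - ∑ i ∈ Finset.range k, T1^[i+1] x / 4^(i+1)

theorem T1_mem_Icc {x : ℝ} (hx : x ∈ Set.Icc (0:ℝ) 1) : T1 x ∈ Set.Icc (0:ℝ) 1 := by
  obtain ⟨h0, h1⟩ := hx
  unfold T1
  split_ifs with h
  · constructor <;> linarith
  · constructor <;> linarith

theorem T1_of_half_le {x : ℝ} (hx : 1/2 ≤ x) : T1 x = 2*(1-x) := by
  unfold T1
  split_ifs with h
  · linarith
  · rfl

theorem ftilde_zero (x : ℝ) : ftilde 0 x = x := by
  simp [ftilde]

theorem ftilde_succ (k : ℕ) (x : ℝ) :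
    ftilde (k+1) x = x - T1 x / 2 + ftilde k (T1 x) / 4 := by
  have h : ∑ i ∈ Finset.range k, T1^[i+1+1] x / 4^(i+1+1)
      = (∑ i ∈ Finset.range k, T1^[i+1] (T1 x) / 4^(i+1)) / 4 := by
    rw [Finset.sum_div]
    refine Finset.sum_congr rfl fun i _ => ?_
    rw [Function.iterate_succ_apply, pow_succ _ (i+1), div_div]
  unfold ftilde
  rw [Finset.sum_range_succ', h]
  simp only [zero_add, Function.iterate_one, pow_one]
  ring

theorem ftilde_succ_sub_sq (k : ℕ) (x : ℝ) :
    ftilde (k+1) x - x^2 = (ftilde k (T1 x) - (T1 x)^2) / 4 := by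
  rw [ftilde_succ]
  have h : x - T1 x / 2 + (T1 x)^2 / 4 = x^2 := by
    unfold T1
    split_ifs <;> ring
  linarith

theorem ftilde_sub_sq_eq (k : ℕ) : ∀ i : ℕ, i < 2^k → ∀ x : ℝ,
    (i : ℝ) / 2^k ≤ x → x ≤ ((i : ℝ) + 1) / 2^k →
    ftilde k x - x^2 = -((x - (i : ℝ) / 2^k) * (x - ((i : ℝ) + 1) / 2^k)) := by
  induction k with
  | zero =>
    intro i hi x _ _
    obtain rfl : i = 0 := by simpa using hi
    simp only [ftilde_zero, Nat.cast_zero, pow_zero]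
    ring
  | succ k ih =>
    intro i hi x hl hu
    have hp : (0:ℝ) < 2^k := by positivity
    rw [pow_succ, div_le_iff₀ (by positivity)] at hl
    rw [pow_succ, le_div_iff₀ (by positivity)] at hu
    rw [ftilde_succ_sub_sq]
    rcases lt_or_ge i (2^k) with h | h
    · have hc : (i : ℝ) + 1 ≤ 2^k := by exact_mod_cast h
      have hT : T1 x = 2*x := if_pos (by nlinarith)
      rw [hT, ih i h (2*x) (by rw [div_le_iff₀ hp]; linarith)
        (by rw [le_div_iff₀ hp]; linarith)]
      field_simp
      ring
    · have hc : (2:ℝ)^k ≤ i := by exact_mod_cast h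
      obtain ⟨j, hj⟩ := Nat.exists_eq_add_of_lt hi
      have hjc : (i : ℝ) = 2 * 2^k - 1 - j := by
        have : (2:ℝ)^(k+1) = i + j + 1 := by exact_mod_cast hj
        rw [pow_succ] at this
        linarith
      have hjk : j < 2^k := by
        rw [pow_succ] at hj
        omega
      rw [T1_of_half_le (by nlinarith), ih j hjk (2*(1-x))
        (by rw [div_le_iff₀ hp]; linarith) (by rw [le_div_iff₀ hp]; linarith), hjc]
      field_simp
      ring

theorem ftilde_sub_sq_mem_Icc (k : ℕ) : ∀ x : ℝ, x ∈ Set.Icc (0:ℝ) 1 →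
    0 ≤ ftilde k x - x^2 ∧ ftilde k x - x^2 ≤ 1 / 4^(k+1) := by
  induction k with
  | zero =>
    rintro x ⟨h0, h1⟩
    rw [ftilde_zero]
    constructor
    · nlinarith
    · norm_num
      nlinarith [sq_nonneg (x - 1/2)]
  | succ k ih =>
    intro x hx
    obtain ⟨h0, h1⟩ := ih (T1 x) (T1_mem_Icc hx)
    rw [ftilde_succ_sub_sq, pow_succ _ (k+1), ← div_div]
    constructor <;> linarith

/-- For every `k ≥ 1`, every `i ∈ {0,…,2^k−1}` and every `x ∈ [0,1]` with
`i/2^k ≤ x ≤ (i+1)/2^k`, `f̃_k(x) − x² = −(x − i/2^k)(x − (i+1)/2^k)`;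
in particular `0 ≤ f̃_k(x) − x² ≤ 4^{−(k+1)}` on `[0,1]`. -/
theorem stmt7 (k : ℕ) (hk : 1 ≤ k) :
    (∀ i : ℕ, i < 2^k → ∀ x : ℝ, x ∈ Set.Icc (0:ℝ) 1 →
      (i : ℝ) / 2^k ≤ x → x ≤ ((i : ℝ) + 1) / 2^k →
      ftilde k x - x^2 = -((x - (i : ℝ) / 2^k) * (x - ((i : ℝ) + 1) / 2^k))) ∧
    (∀ x : ℝ, x ∈ Set.Icc (0:ℝ) 1 →
      0 ≤ ftilde k x - x^2 ∧ ftilde k x - x^2 ≤ 1 / 4^(k+1)) := by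
  exact ⟨fun i hi x _ hl hu => ftilde_sub_sq_eq k i hi x hl hu, ftilde_sub_sq_mem_Icc k⟩
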